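/- (Scalar Jacobi-type comparison on a short interval) Let μ ≥ 0 and L > 0, and let u : [0, ℓ] → ℝ^n solve u'' + R(t)u = 0 where R(t) is a symmetric matrix with operator norm ‖R(t)‖ ≤ μL² for all t, with u(0) = 0. If ℓ · μL² ≤ (π/(2))² / ℓ (equivalently ℓ ≤ π/(2√(μ)L)), then t ↦ |u(t)| / sin(πt/(2ℓ)) is nondecreasing on (0, ℓ]; in particular |u(t)| ≤ |u(ℓ)| · sin(πt/(2ℓ)) for all t ∈ [0, ℓ]. -/

import Mathlib

open Set
open scoped RealInnerProductSpace

theorem jacobi_comparison (n : ℕ) (μ L ℓ : ℝ) (hμ : 0 ≤ μ) (hL : 0 < L) (hℓ : 0 < ℓ)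
    (hshort : Real.sqrt μ * L * ℓ ≤ Real.pi / 2)
    (u u' u'' : ℝ → EuclideanSpace ℝ (Fin n))
    (R : ℝ → EuclideanSpace ℝ (Fin n) →L[ℝ] EuclideanSpace ℝ (Fin n))
    (hsym : ∀ t v w, ⟪R t v, w⟫ = ⟪v, R t w⟫)
    (hbound : ∀ t v, ⟪v, R t v⟫ ≤ μ * L^2 * ‖v‖^2)
    (hd1 : ∀ t ∈ Icc 0 ℓ, HasDerivWithinAt u (u' t) (Icc 0 ℓ) t)
    (hd2 : ∀ t ∈ Icc 0 ℓ, HasDerivWithinAt u' (u'' t) (Icc 0 ℓ) t)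
    (hODE : ∀ t ∈ Icc 0 ℓ, u'' t + R t (u t) = 0)
    (h0 : u 0 = 0) :
    MonotoneOn (fun t => ‖u t‖ / Real.sin (Real.pi * t / (2 * ℓ))) (Ioc 0 ℓ) ∧
    ∀ t ∈ Icc 0 ℓ, ‖u t‖ ≤ ‖u ℓ‖ * Real.sin (Real.pi * t / (2 * ℓ)) := by
  have hpi := Real.pi_pos
  obtain ⟨c, hc⟩ : ∃ c, c = Real.pi / (2 * ℓ) := ⟨_, rfl⟩
  have hcpos : 0 < c := by rw [hc]; positivity
  have hcl : c * ℓ = Real.pi / 2 := by rw [hc]; field_simp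
  have hcc : μ * L ^ 2 ≤ c ^ 2 := by
    have h1 : Real.sqrt μ * L ≤ c := by
      rw [← hcl] at hshort
      exact le_of_mul_le_mul_right hshort hℓ
    calc μ * L ^ 2 = (Real.sqrt μ * L) ^ 2 := by rw [mul_pow, Real.sq_sqrt hμ]
      _ ≤ c ^ 2 := by gcongr
  have harg : ∀ t, Real.pi * t / (2 * ℓ) = c * t := by intro t; rw [hc]; ring
  simp only [harg]
  have hspos : ∀ t ∈ Ioc 0 ℓ, 0 < Real.sin (c * t) := by
    intro t ht
    apply Real.sin_pos_of_pos_of_lt_pi (mul_pos hcpos ht.1)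
    have : c * t ≤ c * ℓ := by gcongr; exact ht.2
    linarith
  have hs : ∀ t, HasDerivAt (fun t => Real.sin (c * t)) (c * Real.cos (c * t)) t := by
    intro t
    have := (Real.hasDerivAt_sin (c * t)).comp t ((hasDerivAt_id t).const_mul c)
    simpa [mul_comm, Function.comp_def] using this
  have hs' : ∀ t, HasDerivAt (fun t => c * Real.cos (c * t)) (-(c ^ 2 * Real.sin (c * t))) t := by
    intro t
    have := ((Real.hasDerivAt_cos (c * t)).comp t ((hasDerivAt_id t).const_mul c)).const_mul c
    refine (this.congr_deriv ?_)
    ring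
  set v : ℝ → EuclideanSpace ℝ (Fin n) := fun t => (Real.sin (c * t))⁻¹ • u t with hv
  set P : ℝ → EuclideanSpace ℝ (Fin n) :=
    fun t => Real.sin (c * t) • u' t - (c * Real.cos (c * t)) • u t with hP
  have hPd : ∀ t ∈ Icc 0 ℓ, HasDerivWithinAt P
      (Real.sin (c * t) • (u'' t + c ^ 2 • u t)) (Icc 0 ℓ) t := by
    intro t ht
    have := ((hs t).hasDerivWithinAt.smul (hd2 t ht)).sub
      ((hs' t).hasDerivWithinAt.smul (hd1 t ht))
    refine this.congr_deriv ?_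
    module
  have hvd : ∀ t ∈ Ioc 0 ℓ, HasDerivWithinAt v
      ((Real.sin (c * t) ^ 2)⁻¹ • P t) (Icc 0 ℓ) t := by
    intro t ht
    have hne := (hspos t ht).ne'
    have := ((hs t).inv hne).hasDerivWithinAt.smul (hd1 t (Ioc_subset_Icc_self ht))
    refine this.congr_deriv ?_
    simp only [hP, smul_sub, smul_smul, Pi.inv_apply]
    rw [sub_eq_add_neg, ← neg_smul]
    congr 2
    · field_simp
    · field_simp
  have hgd : ∀ t ∈ Ioc 0 ℓ, HasDerivWithinAt (fun t => ⟪v t, P t⟫)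
      (⟪v t, Real.sin (c * t) • (u'' t + c ^ 2 • u t)⟫ +
        ⟪(Real.sin (c * t) ^ 2)⁻¹ • P t, P t⟫) (Icc 0 ℓ) t := fun t ht =>
    (hvd t ht).inner ℝ (hPd t (Ioc_subset_Icc_self ht))
  have hgnn : ∀ t ∈ Ioc 0 ℓ, 0 ≤ ⟪v t, Real.sin (c * t) • (u'' t + c ^ 2 • u t)⟫ +
        ⟪(Real.sin (c * t) ^ 2)⁻¹ • P t, P t⟫ := by
    intro t ht
    have hp := hspos t ht
    have e : u'' t = - R t (u t) := eq_neg_of_add_eq_zero_left (hODE t (Ioc_subset_Icc_self ht))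
    apply add_nonneg
    · simp only [hv]
      rw [real_inner_smul_left, real_inner_smul_right, ← mul_assoc, inv_mul_cancel₀ hp.ne', one_mul,
        inner_add_right, real_inner_smul_right, e, inner_neg_right, real_inner_self_eq_norm_sq]
      have := hbound t (u t)
      nlinarith [sq_nonneg ‖u t‖]
    · rw [real_inner_smul_left]
      exact mul_nonneg (by positivity) real_inner_self_nonneg
  have hmono : ∀ (f f' : ℝ → ℝ), (∀ t ∈ Ioc 0 ℓ, HasDerivWithinAt f (f' t) (Icc 0 ℓ) t) →
      (∀ t ∈ Ioc 0 ℓ, 0 ≤ f' t) → MonotoneOn f (Ioc 0 ℓ) := by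
    intro f f' h1 h2
    apply monotoneOn_of_hasDerivWithinAt_nonneg (f' := f') (convex_Ioc 0 ℓ)
    · intro t ht
      exact ((h1 t ht).continuousWithinAt).mono Ioc_subset_Icc_self
    · intro t ht
      exact (h1 t (interior_subset ht)).mono (interior_subset.trans Ioc_subset_Icc_self)
    · intro t ht
      exact h2 t (interior_subset ht)
  have hgm := hmono _ _ hgd hgnn
  have h0m : (0:ℝ) ∈ Icc 0 ℓ := ⟨le_rfl, hℓ.le⟩
  have hfil : nhdsWithin (0:ℝ) (Ioc 0 ℓ) ≤ nhdsWithin 0 (Icc 0 ℓ) :=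
    nhdsWithin_mono _ Ioc_subset_Icc_self
  have hPlim : Filter.Tendsto P (nhdsWithin 0 (Ioc 0 ℓ)) (nhds 0) := by
    have := (hPd 0 h0m).continuousWithinAt.tendsto.mono_left hfil
    simpa [hP, h0] using this
  have hvlim : Filter.Tendsto v (nhdsWithin 0 (Ioc 0 ℓ)) (nhds (c⁻¹ • u' 0)) := by
    have hsub : nhdsWithin (0:ℝ) (Ioc 0 ℓ) ≤ nhdsWithin 0 (Icc 0 ℓ \ {0}) :=
      nhdsWithin_mono _ (fun x hx => ⟨Ioc_subset_Icc_self hx, hx.1.ne'⟩)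
    have a := (hasDerivWithinAt_iff_tendsto_slope.1 (hd1 0 h0m)).mono_left hsub
    have b := (hasDerivWithinAt_iff_tendsto_slope.1
      ((hs 0).hasDerivWithinAt (s := Icc 0 ℓ))).mono_left hsub
    have b' := b.inv₀ (by simpa using hcpos.ne')
    have := b'.smul a
    simp only [mul_zero, Real.cos_zero, mul_one] at this
    refine this.congr' ?_
    filter_upwards [self_mem_nhdsWithin] with t ht
    have := ht.1.ne'
    have := (hspos t ht).ne'
    simp only [slope_def_module, hv, h0, sub_zero, mul_zero, Real.sin_zero, smul_smul, smul_eq_mul]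
    congr 1
    field_simp
  have hglim : Filter.Tendsto (fun t => ⟪v t, P t⟫) (nhdsWithin 0 (Ioc 0 ℓ)) (nhds 0) := by
    simpa using hvlim.inner hPlim
  haveI : (nhdsWithin (0:ℝ) (Ioc 0 ℓ)).NeBot := by
    rw [nhdsWithin_Ioc_eq_nhdsGT hℓ]; infer_instance
  have hg0 : ∀ t ∈ Ioc 0 ℓ, 0 ≤ ⟪v t, P t⟫ := by
    intro t ht
    refine le_of_tendsto hglim ?_
    have : Iic t ∈ nhdsWithin (0:ℝ) (Ioc 0 ℓ) := mem_nhdsWithin_of_mem_nhds (Iic_mem_nhds ht.1)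
    filter_upwards [self_mem_nhdsWithin, this] with r hr hrt
    exact hgm hr ht hrt
  have hvm := hmono (fun t => ⟪v t, v t⟫) _
    (fun t ht => (hvd t ht).inner ℝ (hvd t ht)) (by
      intro t ht
      have := hg0 t ht
      have hp := hspos t ht
      have h2 : 0 ≤ ⟪P t, v t⟫ := by rw [real_inner_comm]; exact this
      rw [real_inner_smul_left (P t), real_inner_smul_right (v t)]
      have h3 : 0 ≤ (Real.sin (c * t) ^ 2)⁻¹ := by positivity
      exact add_nonneg (mul_nonneg h3 this) (mul_nonneg h3 h2))
  have hnorm : ∀ t ∈ Ioc 0 ℓ, ‖u t‖ / Real.sin (c * t) = ‖v t‖ := by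
    intro t ht
    simp only [hv]
    rw [norm_smul, norm_inv, Real.norm_of_nonneg (hspos t ht).le, div_eq_inv_mul]
  have hM : MonotoneOn (fun t => ‖u t‖ / Real.sin (c * t)) (Ioc 0 ℓ) := by
    intro a ha b hb hab
    have := hvm ha hb hab
    simp only [real_inner_self_eq_norm_sq] at this
    simp only [hnorm a ha, hnorm b hb]
    exact le_of_sq_le_sq this (norm_nonneg _)
  refine ⟨hM, ?_⟩
  intro t ht
  rcases ht.1.eq_or_lt with h | h
  · rw [← h, h0]; simp
  · have := hM ⟨h, ht.2⟩ ⟨hℓ, le_rfl⟩ ht.2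
    simp only [hcl, Real.sin_pi_div_two, div_one] at this
    exact (div_le_iff₀ (hspos t ⟨h, ht.2⟩)).1 this
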